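/- For every positive integer n with binary representation n = x_k…x_0 = Σ_{i=0}^k x_i 2^i, the Turing machine M8 halts when started from the initial configuration ω0 (A 1) x_0 1 x_1 1 x_2 … 1 x_k 0ω if and only if there exists m ≥ 0 with T^m(n) = 1. -/

import Mathlib

namespace Collatz

/-- The 3x+1 function. -/
def T (x : ℕ) : ℕ := if x % 2 = 0 then x / 2 else (3 * x + 1) / 2

/-- The 3x+1 conjecture: iterating `T` from any positive integer
eventually reaches the loop `2 ↦ 1 ↦ 2`. -/
def CollatzConjecture : Prop :=
  ∀ x : ℕ, 0 < x → ∃ k : ℕ, T^[k] x = 2 ∧ T^[k + 1] x = 1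

inductive St | A | B | C | D | E | F | G | H | I | J | K | L | M | Z
  deriving DecidableEq

/-- Symbols: `false` is the blank `0`, `true` is `1`. -/
abbrev Sym := Bool

open St

/-- Transition table of the Turing machine `M8`
(`true` = move right, `false` = move left); `Z` is the halting state,
`H` is an ordinary state, `delta I true` is undefined. -/
def delta : St → Sym → Option (Sym × Bool × St)
  | A, false => some (true, true, I)
  | A, true  => some (false, true, L)
  | B, false => some (false, true, A)
  | B, true  => some (false, true, G)
  | C, false => some (false, true, A)
  | C, true  => some (true, true, D)
  | D, false => some (false, true, C)
  | D, true  => some (true, true, E)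
  | E, false => some (true, true, I)
  | E, true  => some (true, true, F)
  | F, false => some (true, true, C)
  | F, true  => some (false, true, G)
  | G, false => some (true, true, C)
  | G, true  => some (true, true, H)
  | H, false => some (false, true, E)
  | H, true  => some (true, true, G)
  | I, false => some (true, false, J)
  | I, true  => none
  | J, false => some (false, true, B)
  | J, true  => some (true, false, K)
  | K, false => some (false, false, J)
  | K, true  => some (true, false, J)
  | L, false => some (false, true, A)
  | L, true  => some (false, true, M)
  | M, false => some (false, false, Z)
  | M, true  => some (true, true, H)
  | Z, _     => none

structure Cfg where
  state : St
  head : ℤ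
  tape : ℤ → Sym

/-- One step of the machine; `none` when the transition is undefined
(in particular in the halting state, which has no transitions).
In `delta`, the `Bool` component is the direction: `true` = right, `false` = left. -/
def step (c : Cfg) : Option Cfg :=
  (delta c.state (c.tape c.head)).map fun t =>
    ⟨t.2.2, c.head + (if t.2.1 then 1 else -1), Function.update c.tape c.head t.1⟩

/-- `steps n c` is the configuration after `n` steps from `c`
(`none` if the machine has halted meanwhile). -/
def steps : ℕ → Cfg → Option Cfg
  | 0, c => some c
  | n + 1, c => (step c).bind (steps n)

/-- The tape holding the word `w` at positions `0, …, w.length - 1`,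
and the blank symbol everywhere else. -/
def tapeOf (w : List Sym) : ℤ → Sym :=
  fun i => if 0 ≤ i then w.getD i.toNat false else false

/-- `c` is the configuration `ωb u (q s) v bω`, where `w = u ++ s :: v` and
`pos = u.length` (i.e. the tape holds exactly the word `w` surrounded by blanks,
the machine is in state `q`, and the head scans the symbol of `w` at index `pos`). -/
def IsConfig (c : Cfg) (q : St) (w : List Sym) (pos : ℕ) : Prop :=
  c.state = q ∧ ∃ d : ℤ, c.head = d + pos ∧ c.tape = fun i => tapeOf w (i - d)

/-- The machine eventually reaches the configuration `ωb u (q s) v bω`. -/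
def Reaches (c : Cfg) (q : St) (w : List Sym) (pos : ℕ) : Prop :=
  ∃ t : ℕ, ∃ c' : Cfg, steps t c = some c' ∧ IsConfig c' q w pos

/-- The machine halts when started from configuration `c`. -/
def Halts (c : Cfg) : Prop := ∃ n : ℕ, steps n c = none

/-- Initial configuration: word `w` on the tape, head on its leftmost symbol, state `A`. -/
def initCfg (w : List Sym) : Cfg := ⟨St.A, 0, tapeOf w⟩

/-- Encoding of a list of binary digits `[x_0, x_1, …, x_k]`
(least significant first) as the word `1 x_0 1 x_1 … 1 x_k`. -/
def codeList : List ℕ → List Sym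
  | [] => []
  | d :: ds => true :: decide (d = 1) :: codeList ds

/-- The word `1 x_0 1 x_1 … 1 x_k` where `x_k … x_0` is the binary
representation of `n`. -/
def codeWord (n : ℕ) : List Sym := codeList (Nat.digits 2 n)

/-- One step on zipper configurations (state, reversed left part, right part). -/
def zstep (z : St × List Bool × List Bool) : Option (St × List Bool × List Bool) :=
  match delta z.1 (z.2.2.headD false) with
  | none => none
  | some (s, true, q) => some (q, s :: z.2.1, z.2.2.tail)
  | some (s, false, q) => some (q, z.2.1.tail, z.2.1.headD false :: s :: z.2.2.tail)

def zsteps : ℕ → St × List Bool × List Bool → Option (St × List Bool × List Bool)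
  | 0, z => some z
  | n + 1, z => (zstep z).bind (zsteps n)

/-- The zipper `z` represents the configuration `c`. -/
def Rep (c : Cfg) (z : St × List Bool × List Bool) : Prop :=
  c.state = z.1 ∧ (∀ i : ℕ, c.tape (c.head + i) = z.2.2.getD i false) ∧
    (∀ i : ℕ, c.tape (c.head - 1 - i) = z.2.1.getD i false)

theorem getD_zero_headD (l : List Bool) : l.getD 0 false = l.headD false := by
  cases l <;> rfl

theorem getD_succ_tail (l : List Bool) (i : ℕ) : l.getD (i + 1) false = l.tail.getD i false := by
  cases l <;> simp

theorem Rep.step_none {c : Cfg} {z} (h : Rep c z) (hz : zstep z = none) : step c = none := by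
  obtain ⟨q, l, r⟩ := z
  obtain ⟨h1, h2, h3⟩ := h
  have h0 := h2 0
  simp only [Nat.cast_zero, add_zero, getD_zero_headD] at h0
  simp only at h1
  unfold step
  rw [h0, h1]
  unfold zstep at hz
  simp only at hz ⊢
  rcases hd : delta q (r.headD false) with _ | ⟨s, _ | _, q'⟩
  · rfl
  · rw [hd] at hz
    simp at hz
  · rw [hd] at hz
    simp at hz

theorem Rep.step_some {c : Cfg} {z z'} (h : Rep c z) (hz : zstep z = some z') :
    ∃ c', step c = some c' ∧ Rep c' z' := by
  obtain ⟨q, l, r⟩ := z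
  obtain ⟨h1, h2, h3⟩ := h
  have h0 := h2 0
  simp only [Nat.cast_zero, add_zero, getD_zero_headD] at h0
  simp only at h1
  unfold step
  rw [h0, h1]
  unfold zstep at hz
  simp only at hz h2 h3 ⊢
  rcases hd : delta q (r.headD false) with _ | ⟨s, _ | _, q'⟩
  · rw [hd] at hz
    simp at hz
  · simp only [hd, Option.some.injEq] at hz
    subst hz
    refine ⟨_, rfl, rfl, ?_, ?_⟩
    · rintro (_ | _ | i)
      · have := h3 0
        rw [getD_zero_headD] at this
        simp only [Nat.cast_zero, sub_zero] at this
        rw [List.getD_cons_zero, ← this]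
        simp [sub_eq_add_neg]
      · simp
      · have := h2 (i + 1)
        rw [getD_succ_tail] at this
        simp only [List.getD_cons_succ, ← this]
        simp only [Bool.false_eq_true, if_false]
        rw [Function.update_of_ne (by push_cast; omega)]
        congr 1
        push_cast; ring
    · intro i
      have := h3 (i + 1)
      rw [getD_succ_tail] at this
      simp only [← this]
      simp only [Bool.false_eq_true, if_false]
      rw [Function.update_of_ne (by push_cast; omega)]
      congr 1
      push_cast; ring
  · simp only [hd, Option.some.injEq] at hz
    subst hz
    refine ⟨_, rfl, rfl, ?_, ?_⟩
    · intro i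
      have := h2 (i + 1)
      rw [getD_succ_tail] at this
      simp only [← this]
      simp only [if_true]
      rw [Function.update_of_ne (by push_cast; omega)]
      congr 1
      push_cast; ring
    · rintro (_ | i)
      · simp
      · have := h3 i
        simp only [List.getD_cons_succ, ← this]
        simp only [if_true]
        rw [Function.update_of_ne (by push_cast; omega)]
        congr 1
        push_cast; ring

theorem Rep.steps_none_iff (k : ℕ) : ∀ {c : Cfg} {z}, Rep c z →
    (steps k c = none ↔ zsteps k z = none) := by
  induction k with
  | zero => intro c z _; simp [steps, zsteps]
  | succ k ih =>
    intro c z h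
    rcases hz : zstep z with _ | z'
    · simp [steps, zsteps, hz, h.step_none hz]
    · obtain ⟨c', hc, h'⟩ := h.step_some hz
      simp [steps, zsteps, hz, hc, ih h']

theorem zsteps_add (a b : ℕ) : ∀ z, zsteps (a + b) z = (zsteps a z).bind (zsteps b) := by
  induction a with
  | zero => intro z; simp [zsteps]
  | succ a ih =>
    intro z
    rw [Nat.add_right_comm]
    rcases hz : zstep z with _ | z' <;> simp [zsteps, hz, ih]

def ZReach (z z' : St × List Bool × List Bool) : Prop := ∃ k, zsteps k z = some z'

theorem ZReach.trans {x y z} (h : ZReach x y) (h' : ZReach y z) : ZReach x z := by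
  obtain ⟨a, ha⟩ := h
  obtain ⟨b, hb⟩ := h'
  exact ⟨a + b, by simp [zsteps_add, ha, hb]⟩

theorem codeWord_zero : codeWord 0 = [] := by simp [codeWord, codeList]

theorem codeWord_even (y : ℕ) (hy : 0 < y) :
    codeWord (2 * y) = true :: false :: codeWord y := by
  have := Nat.digits_add 2 (by norm_num) 0 y (by norm_num) (Or.inr hy.ne')
  rw [zero_add] at this
  simp [codeWord, this, codeList]

theorem codeWord_odd (y : ℕ) :
    codeWord (2 * y + 1) = true :: true :: codeWord y := by
  have := Nat.digits_add 2 (by norm_num) 1 y (by norm_num) (Or.inl (by norm_num))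
  rw [add_comm] at this
  rw [codeWord, this]
  simp [codeWord, codeList]

theorem codeWord_pos (y : ℕ) (hy : 0 < y) : ∃ r, codeWord y = true :: r := by
  rcases Nat.even_or_odd' y with ⟨k, rfl | rfl⟩
  · exact ⟨_, codeWord_even k (by omega)⟩
  · exact ⟨_, codeWord_odd k⟩

/-- State holding the carry `c` in front of a marker. -/
def carrySt : ℕ → St
  | 0 => C
  | 1 => E
  | _ => G

theorem back (l : List Bool) (d : Bool) (y : ℕ) (hy : 0 < y) :
    ZReach (J, d :: true :: l, codeWord y) (J, l, true :: d :: codeWord y) := by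
  obtain ⟨r, hr⟩ := codeWord_pos y hy
  rw [hr]
  refine ⟨2, ?_⟩
  cases d <;> rfl

theorem pass (y : ℕ) : ∀ (c : ℕ) (l : List Bool), c ≤ 2 → 0 < 3 * y + c →
    ZReach (carrySt c, l, codeWord y) (J, l, codeWord (3 * y + c)) := by
  induction y using Nat.strong_induction_on with
  | _ y ih =>
    intro c l hc hpos
    rcases Nat.eq_zero_or_pos y with rfl | hy
    · have e1 : codeWord 1 = [true, true] := by simp [codeWord, codeList]
      have e2 : codeWord 2 = [true, false, true, true] := by simp [codeWord, codeList]
      interval_cases c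
      · omega
      · simp only [mul_zero, zero_add, e1, codeWord_zero]
        exact ⟨2, rfl⟩
      · simp only [mul_zero, zero_add, e2, codeWord_zero]
        exact ⟨6, rfl⟩
    · rcases Nat.even_or_odd' y with ⟨k, rfl | rfl⟩
      · rw [codeWord_even k (by omega)]
        have hk : 0 < k := by omega
        interval_cases c
        · have h := ih k (by omega) 0 (false :: true :: l) (by norm_num) (by omega)
          have e : 3 * (2 * k) + 0 = 2 * (3 * k + 0) := by ring
          rw [e, codeWord_even _ (by omega)]
          exact ZReach.trans ⟨2, rfl⟩ (h.trans (back _ _ _ (by omega)))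
        · have h := ih k (by omega) 0 (true :: true :: l) (by norm_num) (by omega)
          have e : 3 * (2 * k) + 1 = 2 * (3 * k + 0) + 1 := by ring
          rw [e, codeWord_odd]
          exact ZReach.trans ⟨2, rfl⟩ (h.trans (back _ _ _ (by omega)))
        · have h := ih k (by omega) 1 (false :: true :: l) (by norm_num) (by omega)
          have e : 3 * (2 * k) + 2 = 2 * (3 * k + 1) := by ring
          rw [e, codeWord_even _ (by omega)]
          exact ZReach.trans ⟨2, rfl⟩ (h.trans (back _ _ _ (by omega)))
      · rw [codeWord_odd k]
        interval_cases c
        · have h := ih k (by omega) 1 (true :: true :: l) (by norm_num) (by omega)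
          have e : 3 * (2 * k + 1) + 0 = 2 * (3 * k + 1) + 1 := by ring
          rw [e, codeWord_odd]
          exact ZReach.trans ⟨2, rfl⟩ (h.trans (back _ _ _ (by omega)))
        · have h := ih k (by omega) 2 (false :: true :: l) (by norm_num) (by omega)
          have e : 3 * (2 * k + 1) + 1 = 2 * (3 * k + 2) := by ring
          rw [e, codeWord_even _ (by omega)]
          exact ZReach.trans ⟨2, rfl⟩ (h.trans (back _ _ _ (by omega)))
        · have h := ih k (by omega) 2 (true :: true :: l) (by norm_num) (by omega)
          have e : 3 * (2 * k + 1) + 2 = 2 * (3 * k + 2) + 1 := by ring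
          rw [e, codeWord_odd]
          exact ZReach.trans ⟨2, rfl⟩ (h.trans (back _ _ _ (by omega)))

theorem pass_M (y : ℕ) (hy : 0 < y) (l : List Bool) :
    ZReach (M, l, codeWord y) (J, l, codeWord (3 * y + 2)) := by
  obtain ⟨k, hk⟩ := pass y 2 l le_rfl (by omega)
  obtain ⟨r, hr⟩ := codeWord_pos y hy
  rw [hr] at hk ⊢
  cases k with
  | zero => simp [zsteps, carrySt] at hk
  | succ k => exact ⟨k + 1, hk⟩

theorem T_step (n : ℕ) (hn : 2 ≤ n) (l : List Bool) :
    ∃ k l', zsteps (k + 1) (A, l, codeWord n) = some (A, l', codeWord (T n)) := by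
  suffices h : ∃ l', ZReach (A, l, codeWord n) (A, l', codeWord (T n)) ∧
      ∃ z, zstep (A, l, codeWord n) = some z ∧ ZReach z (A, l', codeWord (T n)) by
    obtain ⟨l', -, z, hz, k, hk⟩ := h
    exact ⟨k, l', by simp [zsteps, hz, hk]⟩
  suffices h : ∃ l', ∃ z, zstep (A, l, codeWord n) = some z ∧
      ZReach z (A, l', codeWord (T n)) by
    obtain ⟨l', z, hz, k, hk⟩ := h
    exact ⟨l', ⟨k + 1, by simp [zsteps, hz, hk]⟩, z, hz, k, hk⟩
  rcases Nat.even_or_odd' n with ⟨y, rfl | rfl⟩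
  · have e : T (2 * y) = y := by simp [T]
    rw [e, codeWord_even y (by omega)]
    exact ⟨_, _, rfl, 1, rfl⟩
  · have e : T (2 * y + 1) = 3 * y + 2 := by
      unfold T
      rw [if_neg (by omega)]
      omega
    rw [e, codeWord_odd y]
    refine ⟨false :: false :: l, _, rfl, ?_⟩
    refine ZReach.trans ⟨1, rfl⟩ ((pass_M y (by omega) (false :: false :: l)).trans ?_)
    obtain ⟨r, hr⟩ := codeWord_pos (3 * y + 2) (by omega)
    rw [hr]
    exact ⟨4, rfl⟩

theorem T_pos (n : ℕ) (hn : 0 < n) : 0 < T n := by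
  unfold T
  split_ifs <;> omega

theorem zhalt_one (l : List Bool) : zsteps 4 (A, l, codeWord 1) = none := by
  have e1 : codeWord 1 = [true, true] := by simp [codeWord, codeList]
  rw [e1]
  rfl

theorem halts_of_iter (m : ℕ) : ∀ (n : ℕ) (l : List Bool), 0 < n → T^[m] n = 1 →
    ∃ k, zsteps k (A, l, codeWord n) = none := by
  induction m with
  | zero =>
    intro n l _ h
    simp only [Function.iterate_zero, id] at h
    subst h
    exact ⟨4, zhalt_one l⟩
  | succ m ih =>
    intro n l hn h
    by_cases h1 : n = 1
    · subst h1
      exact ⟨4, zhalt_one l⟩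
    · obtain ⟨k, l', hk⟩ := T_step n (by omega) l
      obtain ⟨j, hj⟩ := ih (T n) l' (T_pos n hn) h
      exact ⟨k + 1 + j, by simp [zsteps_add (k + 1), hk, hj]⟩

theorem zsteps_none_mono {a b : ℕ} (hab : a ≤ b) {z} (h : zsteps a z = none) :
    zsteps b z = none := by
  obtain ⟨c, rfl⟩ := Nat.exists_eq_add_of_le hab
  simp [zsteps_add, h]

theorem iter_of_halts (t : ℕ) : ∀ (n : ℕ) (l : List Bool), 0 < n →
    zsteps t (A, l, codeWord n) = none → ∃ m, T^[m] n = 1 := by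
  induction t using Nat.strong_induction_on with
  | _ t ih =>
    intro n l hn h
    by_cases h1 : n = 1
    · exact ⟨0, h1⟩
    · obtain ⟨k, l', hk⟩ := T_step n (by omega) l
      by_cases hle : t ≤ k + 1
      · rw [zsteps_none_mono hle h] at hk
        simp at hk
      · obtain ⟨j, rfl⟩ := Nat.exists_eq_add_of_le (not_le.mp hle).le
        rw [zsteps_add, hk] at h
        obtain ⟨m, hm⟩ := ih j (by omega) (T n) l' (T_pos n hn) h
        exact ⟨m + 1, hm⟩

theorem rep_init (w : List Bool) : Rep (initCfg w) (A, [], w) := by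
  refine ⟨rfl, ?_, ?_⟩
  · intro i
    simp [initCfg, tapeOf]
  · intro i
    simp only [initCfg, tapeOf]
    rw [if_neg (by omega)]
    simp

/-- For every positive integer `n` with binary representation `n = x_k … x_0`,
the machine `M8` halts when started from `ω0 (A 1) x_0 1 x_1 … 1 x_k 0ω`
iff some iterate of `T` at `n` is `1`. -/
theorem M8_halts_iff_iterate_one (n : ℕ) (hn : 0 < n) :
    Halts (initCfg (codeWord n)) ↔ (∃ m : ℕ, T^[m] n = 1) := by
  have hr := rep_init (codeWord n)
  constructor
  · rintro ⟨t, ht⟩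
    exact iter_of_halts t n [] hn ((hr.steps_none_iff t).1 ht)
  · rintro ⟨m, hm⟩
    obtain ⟨k, hk⟩ := halts_of_iter m n [] hn hm
    exact ⟨k, (hr.steps_none_iff k).2 hk⟩

end Collatz
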